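/- Let n and m be positive integers and let G be a graph in C_{n,m}. Then G is Whitney-maximum in C_{n,m} if and only if G is strong in C_{n,m}. -/

import Mathlib

open MvPolynomial

/-- Number of connected components of the spanning subgraph of a graph on `Fin n`
whose edge set is `s`. -/
noncomputable def ncomp (n : ℕ) (s : Set (Sym2 (Fin n))) : ℕ :=
  Nat.card (SimpleGraph.fromEdgeSet s).ConnectedComponent

/-- `G` is a member of `C_{n,m}`: a connected simple graph on `n` vertices and `m` edges. -/
def IsCnm (n m : ℕ) (G : SimpleGraph (Fin n)) : Prop :=
  G.Connected ∧ G.edgeSet.ncard = m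

/-- `N_i^{(k)}(G)`: the number of spanning subgraphs of `G` (identified with subsets of
`E(G)`) having exactly `i` edges and at most `k` connected components. -/
noncomputable def Ncnt (n : ℕ) (G : SimpleGraph (Fin n)) (i k : ℕ) : ℕ :=
  Set.ncard {s : Set (Sym2 (Fin n)) | s ⊆ G.edgeSet ∧ s.ncard = i ∧ ncomp n s ≤ k}

/-- `N_{i,j}(G)`: the number of spanning subgraphs of `G` having exactly `i` edges and
exactly `j` connected components. -/
noncomputable def Nexact (n : ℕ) (G : SimpleGraph (Fin n)) (i j : ℕ) : ℕ :=
  Set.ncard {s : Set (Sym2 (Fin n)) | s ⊆ G.edgeSet ∧ s.ncard = i ∧ ncomp n s = j}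

/-- The `k`-reliability of `G` at `p`: `R_G^{(k)}(p) = Σ_{i=0}^m N_i^{(k)}(G) p^i (1-p)^{m-i}`. -/
noncomputable def rel (n m : ℕ) (G : SimpleGraph (Fin n)) (k : ℕ) (p : ℝ) : ℝ :=
  ∑ i ∈ Finset.range (m + 1), (Ncnt n G i k : ℝ) * p ^ i * (1 - p) ^ (m - i)

/-- The Tutte polynomial of `G`, `T_G(x,y) = Σ_{H ∈ S(G)} (x-1)^{r(G)-r(H)} (y-1)^{c(H)}`,
where the rank of the spanning subgraph with edge set `s` is `n - ncomp n s`, so that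
`r(G) - r(H) = ncomp n s - ncomp n G.edgeSet`, and the corank is `s.ncard + ncomp n s - n`. -/
noncomputable def tutte (n : ℕ) (G : SimpleGraph (Fin n)) : MvPolynomial (Fin 2) ℝ :=
  ∑ᶠ s ∈ {t : Set (Sym2 (Fin n)) | t ⊆ G.edgeSet},
    (X 0 - 1) ^ (ncomp n s - ncomp n G.edgeSet) * (X 1 - 1) ^ (s.ncard + ncomp n s - n)

/-- The Whitney polynomial of `G`, `W_G(x,y) = Σ_{H ∈ S(G)} x^{r(G)-r(H)} y^{c(H)}`. -/
noncomputable def whitney (n : ℕ) (G : SimpleGraph (Fin n)) : MvPolynomial (Fin 2) ℝ :=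
  ∑ᶠ s ∈ {t : Set (Sym2 (Fin n)) | t ⊆ G.edgeSet},
    X 0 ^ (ncomp n s - ncomp n G.edgeSet) * X 1 ^ (s.ncard + ncomp n s - n)

/-- A bivariate polynomial is nonnegative if all its coefficients are nonnegative. -/
def NonnegPoly (P : MvPolynomial (Fin 2) ℝ) : Prop :=
  ∀ d : Fin 2 →₀ ℕ, 0 ≤ P.coeff d

/-- `G` is Tutte-maximum in `C_{n,m}`. -/
def TutteMaximum (n m : ℕ) (G : SimpleGraph (Fin n)) : Prop :=
  ∀ H : SimpleGraph (Fin n), IsCnm n m H →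
    ∃ P : MvPolynomial (Fin 2) ℝ, NonnegPoly P ∧
      tutte n G - tutte n H = (X 0 + X 1 - X 0 * X 1) * P

/-- `G` is Whitney-maximum in `C_{n,m}`. -/
def WhitneyMaximum (n m : ℕ) (G : SimpleGraph (Fin n)) : Prop :=
  ∀ H : SimpleGraph (Fin n), IsCnm n m H →
    ∃ Q : MvPolynomial (Fin 2) ℝ, NonnegPoly Q ∧
      whitney n G - whitney n H = (1 - X 0 * X 1) * Q

/-- `G` is strong in `C_{n,m}`. -/
def Strong (n m : ℕ) (G : SimpleGraph (Fin n)) : Prop :=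
  ∀ H : SimpleGraph (Fin n), IsCnm n m H →
    ∀ i ≤ m, ∀ k, 1 ≤ k → k ≤ n → Ncnt n H i k ≤ Ncnt n G i k

/-- `G` is a 0-element in `C_{n,m}`. -/
def ZeroElement (n m : ℕ) (G : SimpleGraph (Fin n)) : Prop :=
  ∀ H : SimpleGraph (Fin n), IsCnm n m H → ∀ i ≤ m, Ncnt n H i 1 ≤ Ncnt n G i 1

/-- `t_k(G)`: the number of spanning forests of `G` composed of exactly `k` trees. -/
noncomputable def tcount (n : ℕ) (G : SimpleGraph (Fin n)) (k : ℕ) : ℕ :=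
  Set.ncard {s : Set (Sym2 (Fin n)) |
    s ⊆ G.edgeSet ∧ (SimpleGraph.fromEdgeSet s).IsAcyclic ∧ ncomp n s = k}

/-- `λ^{(k)}(G)`: the minimum number of edges that must be removed from `G` to obtain a
spanning subgraph with more than `k` connected components. -/
noncomputable def lamk (n : ℕ) (G : SimpleGraph (Fin n)) (k : ℕ) : ℕ :=
  sInf {d : ℕ | ∃ D : Set (Sym2 (Fin n)),
    D ⊆ G.edgeSet ∧ D.ncard = d ∧ k < ncomp n (G.edgeSet \ D)}

/-- `∂^{a+b} P / ∂x^a ∂y^b` evaluated at `(0,0)`. -/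
noncomputable def pdevalXY (P : MvPolynomial (Fin 2) ℝ) (a b : ℕ) : ℝ :=
  MvPolynomial.eval (fun _ => (0 : ℝ))
    ((fun q => MvPolynomial.pderiv (0 : Fin 2) q)^[a]
      ((fun q => MvPolynomial.pderiv (1 : Fin 2) q)^[b] P))

/-- Joining one vertex to a representative of every other component makes the graph connected,
so a spanning subgraph has at least `n - |s|` components. -/
lemma le_ncard_add_ncomp (n : ℕ) (hn : 0 < n) (s : Set (Sym2 (Fin n))) :
    n ≤ s.ncard + ncomp n s := by
  classical
  let F := SimpleGraph.fromEdgeSet s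
  let r : Fin n := ⟨0, hn⟩
  let C₀ : F.ConnectedComponent := F.connectedComponentMk r
  let t : Set (Sym2 (Fin n)) := (fun C : F.ConnectedComponent => s(r, C.out)) '' {C₀}ᶜ
  have hcomp : t.ncard + 1 ≤ ncomp n s := by
    have h₁ : t.ncard ≤ ({C₀}ᶜ : Set F.ConnectedComponent).ncard := Set.ncard_image_le
    have h₂ := Set.ncard_add_ncard_compl ({C₀} : Set F.ConnectedComponent)
    rw [Set.ncard_singleton] at h₂
    change _ ≤ Nat.card F.ConnectedComponent
    omega
  let T := SimpleGraph.fromEdgeSet (s ∪ t)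
  have hle : F ≤ T := SimpleGraph.fromEdgeSet_mono Set.subset_union_left
  have hreach : ∀ v, T.Reachable r v := by
    intro v
    have hv : T.Reachable (F.connectedComponentMk v).out v :=
      (SimpleGraph.ConnectedComponent.exact (Quot.out_eq (F.connectedComponentMk v))).mono hle
    by_cases hC : F.connectedComponentMk v = C₀
    · exact (SimpleGraph.ConnectedComponent.exact hC.symm).mono hle
    · refine SimpleGraph.Reachable.trans (SimpleGraph.Adj.reachable ?_) hv
      rw [SimpleGraph.fromEdgeSet_adj]
      refine ⟨Or.inr ⟨_, hC, rfl⟩, fun h => hC ?_⟩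
      have hout := Quot.out_eq (F.connectedComponentMk v)
      rw [← h] at hout
      exact hout.symm
  have hT : T.Connected :=
    { preconnected := fun u v => (hreach u).symm.trans (hreach v)
      nonempty := ⟨r⟩ }
  have h₁ := hT.card_vert_le_card_edgeSet_add_one
  rw [Nat.card_fin, Nat.card_coe_set_eq] at h₁
  have h₂ : T.edgeSet.ncard ≤ (s ∪ t).ncard :=
    by
    rw [SimpleGraph.edgeSet_fromEdgeSet]
    exact Set.ncard_le_ncard Set.sdiff_subset
  have h₃ := Set.ncard_union_le s t
  omega

lemma ncomp_le (n : ℕ) (s : Set (Sym2 (Fin n))) : ncomp n s ≤ n := by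
  have h := Nat.card_le_card_of_surjective (SimpleGraph.fromEdgeSet s).connectedComponentMk
    Quot.mk_surjective
  simpa [ncomp] using h

lemma ncomp_pos (n : ℕ) (hn : 0 < n) (s : Set (Sym2 (Fin n))) : 0 < ncomp n s := by
  have : Nonempty (SimpleGraph.fromEdgeSet s).ConnectedComponent :=
    ⟨SimpleGraph.connectedComponentMk _ ⟨0, hn⟩⟩
  exact Nat.card_pos

lemma ncomp_edgeSet_eq_one {n : ℕ} {G : SimpleGraph (Fin n)} (hG : G.Connected) :
    ncomp n G.edgeSet = 1 := by
  rw [ncomp, SimpleGraph.fromEdgeSet_edgeSet]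
  have := hG.preconnected.subsingleton_connectedComponent
  have := hG.nonempty.map G.connectedComponentMk
  exact Nat.card_eq_one_iff_unique.mpr ⟨inferInstance, inferInstance⟩

lemma Ncnt_zero_right {n : ℕ} (hn : 0 < n) (G : SimpleGraph (Fin n)) (i : ℕ) :
    Ncnt n G i 0 = 0 := by
  have h : {s : Set (Sym2 (Fin n)) | s ⊆ G.edgeSet ∧ s.ncard = i ∧ ncomp n s ≤ 0} = ∅ := by
    ext s
    have := ncomp_pos n hn s
    simp only [Set.mem_ofPred_eq, Set.mem_empty_iff_false, iff_false]
    omega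
  rw [Ncnt, h, Set.ncard_empty]

lemma Ncnt_eq_zero_of_add_lt {n : ℕ} (hn : 0 < n) (G : SimpleGraph (Fin n)) {i k : ℕ}
    (h : i + k < n) : Ncnt n G i k = 0 := by
  have h : {s : Set (Sym2 (Fin n)) | s ⊆ G.edgeSet ∧ s.ncard = i ∧ ncomp n s ≤ k} = ∅ := by
    ext s
    have := le_ncard_add_ncomp n hn s
    simp only [Set.mem_ofPred_eq, Set.mem_empty_iff_false, iff_false]
    omega
  rw [Ncnt, h, Set.ncard_empty]

lemma Ncnt_eq_choose {n : ℕ} (G : SimpleGraph (Fin n)) (i : ℕ) {k : ℕ} (hk : n ≤ k) :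
    Ncnt n G i k = G.edgeSet.ncard.choose i := by
  have hfin := G.edgeSet.toFinite
  rw [Set.ncard_eq_toFinset_card _ hfin, ← Finset.card_powersetCard, ← Set.ncard_coe_finset,
    ← Set.ncard_image_of_injective _ (Finset.coe_injective (α := Sym2 (Fin n))), Ncnt]
  congr 1
  ext s
  simp only [Set.mem_ofPred_eq, Set.mem_image, Finset.mem_coe, Finset.mem_powersetCard]
  constructor
  · rintro ⟨hs, rfl, -⟩
    refine ⟨s.toFinite.toFinset, ⟨?_, (Set.ncard_eq_toFinset_card _ _).symm⟩,
      s.toFinite.coe_toFinset⟩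
    exact s.toFinite.toFinset_mono hs
  · rintro ⟨t, ⟨ht, rfl⟩, rfl⟩
    exact ⟨fun e he => hfin.mem_toFinset.mp (ht he), Set.ncard_coe_finset t,
      (ncomp_le n _).trans hk⟩

lemma Ncnt_eq_zero_of_ncard_lt {n : ℕ} (G : SimpleGraph (Fin n)) {i : ℕ} (k : ℕ)
    (hi : G.edgeSet.ncard < i) : Ncnt n G i k = 0 := by
  have h : {s : Set (Sym2 (Fin n)) | s ⊆ G.edgeSet ∧ s.ncard = i ∧ ncomp n s ≤ k} = ∅ := by
    ext s
    simp only [Set.mem_ofPred_eq, Set.mem_empty_iff_false, iff_false]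
    rintro ⟨hs, rfl, -⟩
    exact hi.not_ge (Set.ncard_le_ncard hs)
  rw [Ncnt, h, Set.ncard_empty]

lemma Ncnt_succ (n : ℕ) (G : SimpleGraph (Fin n)) (i k : ℕ) :
    Ncnt n G i (k + 1) = Ncnt n G i k + Nexact n G i (k + 1) := by
  rw [Ncnt, Ncnt, Nexact, ← Set.ncard_union_eq]
  · congr 1
    ext s
    simp only [Set.mem_ofPred_eq, Set.mem_union]
    grind
  · rw [Set.disjoint_left]
    simp only [Set.mem_ofPred_eq]
    grind

/-- The coefficients of the Whitney polynomial of a connected graph count spanning subgraphs by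
edges and components. -/
lemma coeff_whitney {n : ℕ} (hn : 0 < n) {G : SimpleGraph (Fin n)} (hG : G.Connected)
    (d : Fin 2 →₀ ℕ) :
    (whitney n G).coeff d =
      if d 0 < d 1 + n then (Nexact n G (d 1 + n - 1 - d 0) (d 0 + 1) : ℝ) else 0 := by
  classical
  have hterm : ∀ s : Set (Sym2 (Fin n)),
      (X 0 ^ (ncomp n s - 1) * X 1 ^ (s.ncard + ncomp n s - n) : MvPolynomial (Fin 2) ℝ).coeff d =
        if ncomp n s = d 0 + 1 ∧ s.ncard + d 0 + 1 = d 1 + n then 1 else 0 := by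
    intro s
    have h₁ := ncomp_pos n hn s
    have h₂ := le_ncard_add_ncomp n hn s
    rw [X_pow_eq_monomial, X_pow_eq_monomial, monomial_mul, coeff_monomial, one_mul]
    refine if_congr ?_ rfl rfl
    rw [Finsupp.ext_iff, Fin.forall_fin_two]
    simp
    omega
  rw [whitney, ncomp_edgeSet_eq_one hG, finsum_mem_eq_finite_toFinset_sum _ (Set.toFinite _),
    coeff_sum, Finset.sum_congr rfl fun s _ => hterm s, Finset.sum_boole,
    ← Set.ncard_coe_finset]
  split_ifs with hd
  · rw [Nexact]
    congr 2
    ext s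
    simp only [Finset.coe_filter, Set.Finite.mem_toFinset, Set.mem_ofPred_eq]
    grind
  · have hempty : {s ∈ (Set.toFinite {t : Set (Sym2 (Fin n)) | t ⊆ G.edgeSet}).toFinset |
        ncomp n s = d 0 + 1 ∧ s.ncard + d 0 + 1 = d 1 + n} = ∅ := by
      refine Finset.filter_eq_empty_iff.mpr fun s _ => ?_
      have := ncomp_le n s
      omega
    rw [hempty]
    simp

lemma coeff_one_sub_mul (Q : MvPolynomial (Fin 2) ℝ) (a b : ℕ) :
    ((1 - X 0 * X 1) * Q).coeff (Finsupp.single 0 a + Finsupp.single 1 b) =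
      Q.coeff (Finsupp.single 0 a + Finsupp.single 1 b) -
        if 0 < a ∧ 0 < b then
          Q.coeff (Finsupp.single 0 (a - 1) + Finsupp.single 1 (b - 1)) else 0 := by
  classical
  have hX : (X 0 * X 1 : MvPolynomial (Fin 2) ℝ) =
      monomial (Finsupp.single 0 1 + Finsupp.single 1 1) 1 := by
    rw [X, X, monomial_mul, one_mul]
  rw [sub_mul, one_mul, coeff_sub, hX, coeff_monomial_mul', one_mul]
  congr 1
  refine if_congr ?_ ?_ rfl
  · rw [Finsupp.le_def, Fin.forall_fin_two]
    simp
    omega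
  · congr 1
    ext i
    fin_cases i <;> simp

/-- The coefficient of `x^a y^b` in the quotient of `W_G - W_H` by `1 - xy`. -/
noncomputable def quotCoeff (n : ℕ) (G H : SimpleGraph (Fin n)) (a b : ℕ) : ℝ :=
  if a < b + n then
    (Ncnt n G (b + n - 1 - a) (a + 1) : ℝ) - Ncnt n H (b + n - 1 - a) (a + 1) else 0

lemma coeff_whitney_sub {n : ℕ} (hn : 0 < n) {G H : SimpleGraph (Fin n)} (hG : G.Connected)
    (hH : H.Connected) (a b : ℕ) :
    (whitney n G - whitney n H).coeff (Finsupp.single 0 a + Finsupp.single 1 b) =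
      quotCoeff n G H a b - if 0 < a ∧ 0 < b then quotCoeff n G H (a - 1) (b - 1) else 0 := by
  rw [coeff_sub, coeff_whitney hn hG, coeff_whitney hn hH]
  have h₀ : (Finsupp.single 0 a + Finsupp.single 1 b : Fin 2 →₀ ℕ) 0 = a := by simp
  have h₁ : (Finsupp.single 0 a + Finsupp.single 1 b : Fin 2 →₀ ℕ) 1 = b := by simp
  rw [h₀, h₁, quotCoeff, quotCoeff]
  by_cases hab : a < b + n
  · simp only [if_pos hab, Ncnt_succ n _ _ a]
    by_cases hpos : 0 < a ∧ 0 < b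
    · obtain ⟨a, rfl⟩ := Nat.exists_eq_add_of_lt hpos.1
      obtain ⟨b, rfl⟩ := Nat.exists_eq_add_of_lt hpos.2
      have hi : 0 + b + 1 - 1 + n - 1 - (0 + a + 1 - 1) = 0 + b + 1 + n - 1 - (0 + a + 1) := by
        omega
      rw [if_pos hpos, if_pos (by omega), hi]
      simp only [Nat.zero_add, Nat.add_sub_cancel]
      push_cast
      ring
    · have hzero : ∀ K : SimpleGraph (Fin n), Ncnt n K (b + n - 1 - a) a = 0 := by
        intro K
        rcases Nat.eq_zero_or_pos a with rfl | ha
        · exact Ncnt_zero_right hn K _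
        · exact Ncnt_eq_zero_of_add_lt hn K (by omega)
      rw [if_neg hpos, hzero, hzero]
      simp
  · split_ifs <;> first | omega | simp

lemma single_add_single_eq (d : Fin 2 →₀ ℕ) :
    Finsupp.single 0 (d 0) + Finsupp.single 1 (d 1) = d := by
  ext i
  fin_cases i <;> simp

lemma coeff_eq_quotCoeff {n : ℕ} (hn : 0 < n) {G H : SimpleGraph (Fin n)} (hG : G.Connected)
    (hH : H.Connected) {Q : MvPolynomial (Fin 2) ℝ}
    (hQ : whitney n G - whitney n H = (1 - X 0 * X 1) * Q) (a b : ℕ) :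
    Q.coeff (Finsupp.single 0 a + Finsupp.single 1 b) = quotCoeff n G H a b := by
  induction a generalizing b with
  | zero =>
    have h := coeff_whitney_sub hn hG hH 0 b
    rw [hQ, coeff_one_sub_mul] at h
    simpa using h
  | succ a ih =>
    have h := coeff_whitney_sub hn hG hH (a + 1) b
    rw [hQ, coeff_one_sub_mul, Nat.add_sub_cancel, ih] at h
    linarith

lemma quotCoeff_eq_zero {n m : ℕ} {G H : SimpleGraph (Fin n)} (hG : IsCnm n m G)
    (hH : IsCnm n m H) {a b : ℕ} (hab : n ≤ a ∨ m < b) : quotCoeff n G H a b = 0 := by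
  rw [quotCoeff]
  split_ifs with h
  · by_cases ha : n ≤ a + 1
    · rw [Ncnt_eq_choose G _ ha, Ncnt_eq_choose H _ ha, hG.2, hH.2, sub_self]
    · rw [Ncnt_eq_zero_of_ncard_lt G _ (by rw [hG.2]; omega),
        Ncnt_eq_zero_of_ncard_lt H _ (by rw [hH.2]; omega), sub_self]
  · rfl

lemma exists_coeff_eq_quotCoeff {n m : ℕ} {G H : SimpleGraph (Fin n)} (hG : IsCnm n m G)
    (hH : IsCnm n m H) : ∃ Q : MvPolynomial (Fin 2) ℝ,
      ∀ d, Q.coeff d = quotCoeff n G H (d 0) (d 1) := by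
  classical
  let S : Finset (Fin 2 →₀ ℕ) := Finset.Iic (Finsupp.single 0 n + Finsupp.single 1 m)
  refine ⟨∑ d ∈ S, monomial d (quotCoeff n G H (d 0) (d 1)), fun d => ?_⟩
  simp only [coeff_sum, coeff_monomial, Finset.sum_ite_eq']
  split_ifs with hd
  · rfl
  · refine (quotCoeff_eq_zero hG hH ?_).symm
    rw [Finset.mem_Iic, Finsupp.le_def, Fin.forall_fin_two] at hd
    simp at hd
    omega

/-- a graph in `C_{n,m}` is Whitney-maximum if and only if it is strong. -/
theorem stmt12 (n m : ℕ) (hn : 0 < n) (hm : 0 < m) (G : SimpleGraph (Fin n))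
    (hG : IsCnm n m G) :
    WhitneyMaximum n m G ↔ Strong n m G := by
  constructor
  · intro hW H hH i hi k hk₁ hkn
    obtain ⟨Q, hQ, hGH⟩ := hW H hH
    rcases lt_or_ge (i + k) n with hlt | hge
    · rw [Ncnt_eq_zero_of_add_lt hn H hlt]
      exact Nat.zero_le _
    · have h := hQ (Finsupp.single 0 (k - 1) + Finsupp.single 1 (i + k - n))
      rw [coeff_eq_quotCoeff hn hG.1 hH.1 hGH, quotCoeff, if_pos (by omega),
        Nat.sub_add_cancel hk₁, show i + k - n + n - 1 - (k - 1) = i by omega] at h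
      exact_mod_cast sub_nonneg.mp h
  · intro hS H hH
    obtain ⟨Q, hQ⟩ := exists_coeff_eq_quotCoeff hG hH
    refine ⟨Q, fun d => ?_, ?_⟩
    · rw [hQ]
      by_cases hd : n ≤ d 0 ∨ m < d 1
      · exact (quotCoeff_eq_zero hG hH hd).ge
      · rw [quotCoeff, if_pos (by omega), sub_nonneg, Nat.cast_le]
        rcases le_or_gt (d 1 + n - 1 - d 0) m with hi | hi
        · exact hS H hH _ hi _ (by omega) (by omega)
        · rw [Ncnt_eq_zero_of_ncard_lt H _ (by rwa [hH.2])]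
          exact Nat.zero_le _
    · ext d
      rw [← single_add_single_eq d, coeff_whitney_sub hn hG.1 hH.1, coeff_one_sub_mul, hQ, hQ]
      simp
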